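/- arXiv:2210.14894 — 2 statements merged into one kernel-verified Lean document; each statement's English description precedes it below -/
import Mathlib

section
/- Let O be an observable on n qubits with Pauli expansion O = ∑_P α_P P, and let O^(k) = ∑_{P : |P| < k} α_P P be its truncation to Pauli strings of weight less than k. Let 𝒟 be any distribution over n-qubit density matrices invariant under single-qubit Clifford gates applied to any qubit. Then E_{ρ∼𝒟} |Tr(Oρ) - Tr(O^(k)ρ)|² ≤ (2/3)^k ‖O‖², where ‖O‖ is the spectral norm. -/
open scoped BigOperators
open Matrix MeasureTheory ComplexOrder

noncomputable instance matrixMeasurableSpace {m n : Type*} :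
    MeasurableSpace (Matrix m n ℂ) := MeasurableSpace.pi

/-- The four single-qubit Pauli matrices `I, X, Y, Z`. -/
noncomputable def pauli : Fin 4 → Matrix (Fin 2) (Fin 2) ℂ
  | 0 => 1
  | 1 => !![0, 1; 1, 0]
  | 2 => !![0, -Complex.I; Complex.I, 0]
  | 3 => !![1, 0; 0, -1]

/-- The `n`-qubit Pauli string `P₁ ⊗ ⋯ ⊗ Pₙ`. -/
noncomputable def pauliString {n : ℕ} (P : Fin n → Fin 4) :
    Matrix (Fin n → Fin 2) (Fin n → Fin 2) ℂ :=
  fun x y => ∏ i, pauli (P i) (x i) (y i)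

/-- The support (set of qubits acted on nontrivially) of a Pauli string. -/
def psupp {n : ℕ} (P : Fin n → Fin 4) : Finset (Fin n) :=
  Finset.univ.filter (fun i => P i ≠ 0)

/-- A single-qubit gate `U` embedded at qubit `i` of an `n`-qubit system
(`U` on qubit `i`, identity elsewhere). -/
noncomputable def embedAt {n : ℕ} (i : Fin n) (U : Matrix (Fin 2) (Fin 2) ℂ) :
    Matrix (Fin n → Fin 2) (Fin n → Fin 2) ℂ :=
  fun x y => U (x i) (y i) * ∏ j ∈ Finset.univ.erase i, (if x j = y j then 1 else 0)

/-- `U` is a single-qubit Clifford gate: a unitary mapping each nontrivial Pauli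
to a signed nontrivial Pauli under conjugation. -/
def IsSingleQubitClifford (U : Matrix (Fin 2) (Fin 2) ℂ) : Prop :=
  U ∈ unitary (Matrix (Fin 2) (Fin 2) ℂ) ∧
  ∀ p : Fin 4, p ≠ 0 → ∃ q : Fin 4, q ≠ 0 ∧
    (U * pauli p * Uᴴ = pauli q ∨ U * pauli p * Uᴴ = -pauli q)

/-- The tensor product of single-qubit matrices. -/
noncomputable def tensorMatrix {n : ℕ} (A : Fin n → Matrix (Fin 2) (Fin 2) ℂ) :
    Matrix (Fin n → Fin 2) (Fin n → Fin 2) ℂ :=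
  fun x y => ∏ i, A i (x i) (y i)

lemma tensorMatrix_mul {n : ℕ} (A B : Fin n → Matrix (Fin 2) (Fin 2) ℂ) :
    tensorMatrix A * tensorMatrix B = tensorMatrix (fun i => A i * B i) := by
  ext x y
  simp only [tensorMatrix, Matrix.mul_apply, ← Finset.prod_mul_distrib]
  rw [Finset.prod_univ_sum, Fintype.piFinset_univ]

lemma tensorMatrix_conjTranspose {n : ℕ} (A : Fin n → Matrix (Fin 2) (Fin 2) ℂ) :
    (tensorMatrix A)ᴴ = tensorMatrix (fun i => (A i)ᴴ) := by
  ext x y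
  simp [tensorMatrix, Matrix.conjTranspose_apply]

lemma tensorMatrix_update_smul {n : ℕ} (A : Fin n → Matrix (Fin 2) (Fin 2) ℂ) (i : Fin n)
    (c : ℂ) (M : Matrix (Fin 2) (Fin 2) ℂ) :
    tensorMatrix (Function.update A i (c • M)) =
      c • tensorMatrix (Function.update A i M) := by
  ext x y
  simp only [tensorMatrix, Matrix.smul_apply, smul_eq_mul]
  rw [← Finset.mul_prod_erase _ _ (Finset.mem_univ i),
    ← Finset.mul_prod_erase _ _ (Finset.mem_univ i)]
  simp only [Function.update_self, Matrix.smul_apply, smul_eq_mul, mul_assoc]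
  congr 2
  refine Finset.prod_congr rfl fun j hj => ?_
  rw [Function.update_of_ne (Finset.ne_of_mem_erase hj),
    Function.update_of_ne (Finset.ne_of_mem_erase hj)]

lemma embedAt_eq_tensorMatrix {n : ℕ} (i : Fin n) (U : Matrix (Fin 2) (Fin 2) ℂ) :
    embedAt i U = tensorMatrix (Function.update (fun _ => 1) i U) := by
  ext x y
  simp only [tensorMatrix, embedAt]
  rw [← Finset.mul_prod_erase _ _ (Finset.mem_univ i)]
  simp only [Function.update_self]
  congr 1
  refine Finset.prod_congr rfl fun j hj => ?_
  rw [Function.update_of_ne (Finset.ne_of_mem_erase hj), Matrix.one_apply]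

lemma pauliString_eq_tensorMatrix {n : ℕ} (P : Fin n → Fin 4) :
    pauliString P = tensorMatrix (fun i => pauli (P i)) := rfl

/-- Conjugating a state by a gate on qubit `i` conjugates the observed Pauli at qubit `i`. -/
lemma trace_pauliString_embedAt_conj {n : ℕ} (P : Fin n → Fin 4) (i : Fin n)
    (U : Matrix (Fin 2) (Fin 2) ℂ) (c : ℂ) (q : Fin 4)
    (h : Uᴴ * pauli (P i) * U = c • pauli q)
    (ρ : Matrix (Fin n → Fin 2) (Fin n → Fin 2) ℂ) :
    (pauliString P * (embedAt i U * ρ * (embedAt i U)ᴴ)).trace =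
      c * (pauliString (Function.update P i q) * ρ).trace := by
  have key : (embedAt i U)ᴴ * pauliString P * embedAt i U =
      c • pauliString (Function.update P i q) := by
    rw [embedAt_eq_tensorMatrix, pauliString_eq_tensorMatrix, pauliString_eq_tensorMatrix,
      tensorMatrix_conjTranspose, tensorMatrix_mul, tensorMatrix_mul]
    have : (fun j => pauli (Function.update P i q j)) =
        Function.update (fun j => pauli (P j)) i (pauli q) := by
      funext j
      by_cases hj : j = i
      · subst hj; simp
      · simp [Function.update_of_ne hj]
    rw [this, ← tensorMatrix_update_smul]
    congr 1
    funext j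
    by_cases hj : j = i
    · subst hj; simpa using h
    · simp [Function.update_of_ne hj]
  rw [← Matrix.mul_assoc, Matrix.trace_mul_comm, ← Matrix.mul_assoc, ← Matrix.mul_assoc, key, Matrix.smul_mul, Matrix.trace_smul, smul_eq_mul]

lemma pauli_conjTranspose (p : Fin 4) : (pauli p)ᴴ = pauli p := by
  fin_cases p <;> ext a b <;> fin_cases a <;> fin_cases b <;>
    simp [pauli, Matrix.conjTranspose_apply]

lemma pauli_mul_self (p : Fin 4) : pauli p * pauli p = 1 := by
  fin_cases p <;> ext a b <;> fin_cases a <;> fin_cases b <;>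
    simp [pauli, Matrix.mul_apply, Matrix.one_apply]

/-- `1` if the Paulis `w` and `p` commute and `-1` if they anticommute. -/
def pauliSign (w p : Fin 4) : ℝ := if w = 0 ∨ p = 0 ∨ w = p then 1 else -1

lemma pauli_conj_pauli (w p : Fin 4) :
    pauli w * pauli p * pauli w = (pauliSign w p : ℂ) • pauli p := by
  fin_cases w <;> fin_cases p <;> ext a b <;> fin_cases a <;> fin_cases b <;>
    simp [pauli, pauliSign, Matrix.mul_apply, Matrix.one_apply]

lemma isSingleQubitClifford_pauli (w : Fin 4) : IsSingleQubitClifford (pauli w) := by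
  refine ⟨?_, fun p hp => ⟨p, hp, ?_⟩⟩
  · rw [Unitary.mem_iff, Matrix.star_eq_conjTranspose, pauli_conjTranspose]
    exact ⟨pauli_mul_self w, pauli_mul_self w⟩
  · rw [pauli_conjTranspose, pauli_conj_pauli, pauliSign]
    split_ifs <;> simp

lemma exists_pauliSign_mul_eq_neg_one {p q : Fin 4} (h : p ≠ q) :
    ∃ w, pauliSign w p * pauliSign w q = -1 := by
  by_cases hp : p = 0
  · subst hp
    obtain ⟨w, hw, hwq⟩ : ∃ w : Fin 4, w ≠ 0 ∧ w ≠ q := by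
      revert q; decide
    exact ⟨w, by simp [pauliSign, hw, hwq, h.symm]⟩
  · by_cases hq : q = 0
    · subst hq
      obtain ⟨w, hw, hwp⟩ : ∃ w : Fin 4, w ≠ 0 ∧ w ≠ p := by
        clear h hp; revert p; decide
      exact ⟨w, by simp [pauliSign, hw, hwp, h]⟩
    · exact ⟨p, by simp [pauliSign, hp, hq, h]⟩

/-- The Hermitian Clifford gate exchanging the Paulis `p` and `q`. -/
noncomputable def pauliSwap (p q : Fin 4) : Matrix (Fin 2) (Fin 2) ℂ :=
  ((√2 : ℝ) : ℂ)⁻¹ • (pauli p + pauli q)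

lemma pauliSwap_conjTranspose (p q : Fin 4) : (pauliSwap p q)ᴴ = pauliSwap p q := by
  simp [pauliSwap, Matrix.conjTranspose_smul, pauli_conjTranspose]

lemma inv_sqrt_two_mul_self : ((√2 : ℝ) : ℂ)⁻¹ * ((√2 : ℝ) : ℂ)⁻¹ = 1 / 2 := by
  rw [← mul_inv, ← Complex.ofReal_mul, Real.mul_self_sqrt (by norm_num)]
  norm_num

lemma pauliSwap_conj (p q : Fin 4) (A : Matrix (Fin 2) (Fin 2) ℂ) :
    pauliSwap p q * A * pauliSwap p q =
      (1 / 2 : ℂ) • ((pauli p + pauli q) * A * (pauli p + pauli q)) := by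
  simp only [pauliSwap, Matrix.smul_mul, Matrix.mul_smul, smul_smul, inv_sqrt_two_mul_self]

lemma pauli_anticomm {p q : Fin 4} (hp : p ≠ 0) (hq : q ≠ 0) (h : p ≠ q) :
    pauli p * pauli q = -(pauli q * pauli p) := by
  have hs := pauli_conj_pauli p q
  simp only [pauliSign, hp, hq, h, or_self, if_false] at hs
  calc pauli p * pauli q = pauli p * pauli q * pauli p * pauli p := by
        rw [Matrix.mul_assoc, pauli_mul_self, Matrix.mul_one]
    _ = _ := by rw [hs]; simp

lemma pauliSwap_conj_left {p q : Fin 4} (hp : p ≠ 0) (hq : q ≠ 0) (h : p ≠ q) :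
    pauliSwap p q * pauli p * pauliSwap p q = pauli q := by
  rw [pauliSwap_conj]
  have h1 : (pauli p + pauli q) * pauli p * (pauli p + pauli q) =
      pauli p * pauli p * pauli p + pauli p * pauli p * pauli q +
        pauli q * (pauli p * pauli p) + pauli q * pauli p * pauli q := by noncomm_ring
  have h2 := pauli_conj_pauli q p
  simp only [pauliSign, hp, hq, h.symm, or_self, if_false] at h2
  rw [h1, h2]
  simp only [pauli_mul_self, Matrix.one_mul, Matrix.mul_one]
  ext a b
  simp
  ring

lemma pauliSwap_conj_other {p q r : Fin 4} (hp : p ≠ 0) (hq : q ≠ 0) (h : p ≠ q)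
    (hr : r ≠ 0) (hrp : r ≠ p) (hrq : r ≠ q) :
    pauliSwap p q * pauli r * pauliSwap p q = -pauli r := by
  rw [pauliSwap_conj]
  have h1 : (pauli p + pauli q) * pauli r = -(pauli r * (pauli p + pauli q)) := by
    rw [add_mul, mul_add, pauli_anticomm hp hr hrp.symm, pauli_anticomm hq hr hrq.symm]
    abel
  have h2 : (pauli p + pauli q) * (pauli p + pauli q) = (2 : ℂ) • 1 := by
    have : (pauli p + pauli q) * (pauli p + pauli q) =
      pauli p * pauli p + pauli p * pauli q + pauli q * pauli p + pauli q * pauli q := by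
      noncomm_ring
    rw [this, pauli_anticomm hp hq h, pauli_mul_self, pauli_mul_self, two_smul]
    abel
  rw [h1, neg_mul, Matrix.mul_assoc, h2, Matrix.mul_smul, Matrix.mul_one, smul_neg, smul_smul]
  norm_num

lemma pauliSwap_comm (p q : Fin 4) : pauliSwap p q = pauliSwap q p := by
  rw [pauliSwap, pauliSwap, add_comm]

lemma isSingleQubitClifford_pauliSwap {p q : Fin 4} (hp : p ≠ 0) (hq : q ≠ 0) (h : p ≠ q) :
    IsSingleQubitClifford (pauliSwap p q) := by
  have hsq : pauliSwap p q * pauliSwap p q = 1 := by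
    have h2 := pauliSwap_conj_left hp hq h
    have h3 : pauliSwap p q * pauli p = pauli q * pauliSwap p q := by
      simp only [pauliSwap, Matrix.smul_mul, Matrix.mul_smul, add_mul, mul_add, pauli_mul_self,
        add_comm]
    rw [h3, Matrix.mul_assoc] at h2
    calc pauliSwap p q * pauliSwap p q
        = pauli q * (pauli q * (pauliSwap p q * pauliSwap p q)) := by
          rw [← Matrix.mul_assoc, pauli_mul_self, Matrix.one_mul]
      _ = 1 := by rw [h2, pauli_mul_self]
  refine ⟨?_, fun r hr => ?_⟩
  · rw [Unitary.mem_iff, Matrix.star_eq_conjTranspose, pauliSwap_conjTranspose]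
    exact ⟨hsq, hsq⟩
  · rw [pauliSwap_conjTranspose]
    by_cases hrp : r = p
    · exact ⟨q, hq, Or.inl (by rw [hrp, pauliSwap_conj_left hp hq h])⟩
    · by_cases hrq : r = q
      · refine ⟨p, hp, Or.inl ?_⟩
        rw [hrq, pauliSwap_comm, pauliSwap_conj_left hq hp h.symm]
      · exact ⟨r, hr, Or.inr (pauliSwap_conj_other hp hq h hr hrp hrq)⟩

lemma sum_pauli_mul_star (x y u v : Fin 2) :
    ∑ q, pauli q x y * star (pauli q u v) = if x = u ∧ v = y then 2 else 0 := by
  rw [Fin.sum_univ_four]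
  fin_cases x <;> fin_cases y <;> fin_cases u <;> fin_cases v <;>
    simp [pauli] <;> norm_num

lemma sum_star_pauli_mul_pauli (p q : Fin 4) :
    ∑ x, ∑ y, star (pauli p x y) * pauli q x y = if p = q then 2 else 0 := by
  fin_cases p <;> fin_cases q <;>
    simp [pauli, Matrix.one_apply, Fin.sum_univ_two] <;> norm_num

/-- The Pauli strings supported inside `S`. -/
def pauliOn {n : ℕ} (S : Finset (Fin n)) : Finset (Fin n → Fin 4) :=
  Fintype.piFinset fun i => if i ∈ S then Finset.univ else {0}

lemma sum_pauliString_mul_star {n : ℕ} (S : Finset (Fin n)) (x y u v : Fin n → Fin 2) :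
    ∑ Q ∈ pauliOn S, pauliString Q x y * star (pauliString Q u v) =
      if x = S.piecewise u y ∧ v = S.piecewise y u then (2 : ℂ) ^ S.card else 0 := by
  have hsite : ∀ i, ∑ q ∈ (if i ∈ S then Finset.univ else {0}),
      pauli q (x i) (y i) * star (pauli q (u i) (v i)) =
      if x i = S.piecewise u y i ∧ v i = S.piecewise y u i then
        (if i ∈ S then (2 : ℂ) else 1) else 0 := by
    intro i
    by_cases hi : i ∈ S
    · simp only [hi, if_true, sum_pauli_mul_star, Finset.piecewise_eq_of_mem]
    · simp only [hi, if_false, Finset.sum_singleton, Finset.piecewise_eq_of_notMem,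
        not_false_eq_true, pauli, Matrix.one_apply]
      by_cases h1 : x i = y i <;> by_cases h2 : u i = v i <;> simp [h1, h2, eq_comm]
  simp only [pauliString, star_prod, ← Finset.prod_mul_distrib]
  rw [pauliOn, ← Finset.prod_univ_sum (fun i => if i ∈ S then Finset.univ else {0})
    (fun i q => pauli q (x i) (y i) * star (pauli q (u i) (v i)))]
  simp only [hsite]
  rw [Finset.prod_ite_zero]
  simp [funext_iff, forall_and]

/-- The purity of the marginal on `S`, written through Pauli coefficients. -/
lemma sum_norm_trace_pauliString_sq {n : ℕ} (S : Finset (Fin n))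
    (ρ : Matrix (Fin n → Fin 2) (Fin n → Fin 2) ℂ) :
    ((∑ Q ∈ pauliOn S, ‖(pauliString Q * ρ).trace‖ ^ 2 : ℝ) : ℂ) =
      2 ^ S.card * ∑ y, ∑ u, ρ y (S.piecewise u y) * star (ρ (S.piecewise y u) u) := by
  have hQ : ∀ Q : Fin n → Fin 4, ((‖(pauliString Q * ρ).trace‖ ^ 2 : ℝ) : ℂ) =
      ∑ y, ∑ u, ∑ x, ∑ v, (pauliString Q x y * star (pauliString Q u v)) *
        (ρ y x * star (ρ v u)) := by
    intro Q
    rw [Complex.ofReal_pow, ← Complex.mul_conj']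
    simp only [Matrix.trace, Matrix.diag_apply, Matrix.mul_apply]
    nth_rewrite 1 [Finset.sum_comm]
    rw [← Complex.star_def, star_sum, Finset.sum_mul_sum]
    refine Finset.sum_congr rfl fun y _ => Finset.sum_congr rfl fun u _ => ?_
    rw [star_sum, Finset.sum_mul_sum]
    refine Finset.sum_congr rfl fun x _ => Finset.sum_congr rfl fun v _ => ?_
    rw [star_mul']
    ring
  rw [Complex.ofReal_sum]
  simp only [hQ]
  rw [Finset.sum_comm, Finset.mul_sum]
  refine Finset.sum_congr rfl fun y _ => ?_
  rw [Finset.sum_comm, Finset.mul_sum]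
  refine Finset.sum_congr rfl fun u _ => ?_
  rw [Finset.sum_comm, Finset.sum_eq_single (S.piecewise u y) _ (by simp)]
  · rw [Finset.sum_comm, Finset.sum_eq_single (S.piecewise y u) _ (by simp)]
    · rw [← Finset.sum_mul, sum_pauliString_mul_star]
      simp
    · intro v _ hv
      rw [← Finset.sum_mul, sum_pauliString_mul_star]
      simp [hv]
  · intro x _ hx
    rw [Finset.sum_comm]
    refine Finset.sum_eq_zero fun v _ => ?_
    rw [← Finset.sum_mul, sum_pauliString_mul_star]
    simp [hx]

lemma Matrix.PosSemidef.norm_apply_sq_le {ι : Type*} {ρ : Matrix ι ι ℂ}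
    (h : ρ.PosSemidef) (x y : ι) : ‖ρ x y‖ ^ 2 ≤ (ρ x x).re * (ρ y y).re := by
  have hd := (h.submatrix ![x, y]).det_nonneg
  have hxx : (ρ x x).im = 0 := by
    have := congrArg Complex.im (h.isHermitian.apply x x)
    simp at this; linarith
  rw [Matrix.det_fin_two] at hd
  simp only [Matrix.submatrix_apply, Matrix.cons_val_zero, Matrix.cons_val_one] at hd
  rw [← h.isHermitian.apply y x, Complex.star_def, Complex.mul_conj'] at hd
  have := (Complex.le_def.1 hd).1
  rw [← Complex.ofReal_pow] at this
  simp only [Complex.sub_re, Complex.mul_re, hxx, Complex.zero_re, Complex.ofReal_re] at this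
  linarith

lemma Matrix.PosSemidef.re_apply_self_nonneg {ι : Type*} {ρ : Matrix ι ι ℂ}
    (h : ρ.PosSemidef) (x : ι) : 0 ≤ (ρ x x).re :=
  (Complex.le_def.1 (h.diag_nonneg (i := x))).1

lemma sum_norm_trace_pauliString_sq_le {n : ℕ} (S : Finset (Fin n))
    {ρ : Matrix (Fin n → Fin 2) (Fin n → Fin 2) ℂ} (hρ : ρ.PosSemidef) (htr : ρ.trace = 1) :
    ∑ Q ∈ pauliOn S, ‖(pauliString Q * ρ).trace‖ ^ 2 ≤ 2 ^ S.card := by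
  set d : (Fin n → Fin 2) → ℝ := fun x => (ρ x x).re with hd
  have hd0 : ∀ x, 0 ≤ d x := fun x => hρ.re_apply_self_nonneg x
  have hd1 : ∑ x, d x = 1 := by
    have := congrArg Complex.re htr
    simpa [Matrix.trace] using this
  have hterm : ∀ y u : Fin n → Fin 2,
      ‖ρ y (S.piecewise u y) * star (ρ (S.piecewise y u) u)‖ ≤
        (d y * d u + d (S.piecewise y u) * d (S.piecewise u y)) / 2 := by
    intro y u
    have h1 := hρ.norm_apply_sq_le y (S.piecewise u y)
    have h2 := hρ.norm_apply_sq_le (S.piecewise y u) u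
    rw [norm_mul, norm_star]
    refine abs_le_of_sq_le_sq' ?_ ?_ |>.2
    · have h3 := mul_le_mul h1 h2 (sq_nonneg _) (mul_nonneg (hd0 _) (hd0 _))
      rw [mul_pow]
      refine h3.trans ?_
      change d y * d (S.piecewise u y) * (d (S.piecewise y u) * d u) ≤ _
      nlinarith [sq_nonneg (d y * d u - d (S.piecewise y u) * d (S.piecewise u y))]
    · have := mul_nonneg (hd0 y) (hd0 u)
      have := mul_nonneg (hd0 (S.piecewise y u)) (hd0 (S.piecewise u y))
      positivity
  have hprod : ∑ y, ∑ u, d y * d u = 1 := by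
    rw [← Finset.sum_mul_sum, hd1, mul_one]
  have hswap : ∑ y, ∑ u, d (S.piecewise y u) * d (S.piecewise u y) = 1 := by
    rw [← hprod, ← Fintype.sum_prod_type', ← Fintype.sum_prod_type']
    have hinv : Function.Involutive (fun z : (Fin n → Fin 2) × (Fin n → Fin 2) =>
        (S.piecewise z.1 z.2, S.piecewise z.2 z.1)) := by
      rintro ⟨y, u⟩
      ext i <;> by_cases hi : i ∈ S <;> simp [hi]
    exact Equiv.sum_comp hinv.toPerm (fun z => d z.1 * d z.2)
  have hnorm := congrArg norm (sum_norm_trace_pauliString_sq S ρ)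
  rw [Complex.norm_real, Real.norm_of_nonneg (by positivity), norm_mul, norm_pow,
    Complex.norm_ofNat] at hnorm
  rw [hnorm]
  refine mul_le_of_le_one_right (by positivity) ?_
  calc _ ≤ ∑ y, ∑ u, ‖ρ y (S.piecewise u y) * star (ρ (S.piecewise y u) u)‖ :=
        (norm_sum_le _ _).trans (Finset.sum_le_sum fun y _ => norm_sum_le _ _)
    _ ≤ ∑ y, ∑ u, (d y * d u + d (S.piecewise y u) * d (S.piecewise u y)) / 2 :=
        Finset.sum_le_sum fun y _ => Finset.sum_le_sum fun u _ => hterm y u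
    _ = 1 := by
        simp only [← Finset.sum_div, Finset.sum_add_distrib]
        rw [hprod, hswap]; norm_num

lemma sum_star_pauliString_mul {n : ℕ} (P Q : Fin n → Fin 4) :
    ∑ x, ∑ y, star (pauliString P x y) * pauliString Q x y = if P = Q then 2 ^ n else 0 := by
  simp only [pauliString, star_prod, ← Finset.prod_mul_distrib]
  have h1 : ∀ x : Fin n → Fin 2,
      ∑ y : Fin n → Fin 2, ∏ i, star (pauli (P i) (x i) (y i)) * pauli (Q i) (x i) (y i) =
      ∏ i, ∑ b, star (pauli (P i) (x i) b) * pauli (Q i) (x i) b := by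
    intro x
    rw [Finset.prod_univ_sum, Fintype.piFinset_univ]
  simp only [h1]
  rw [← Fintype.piFinset_univ, ← Finset.prod_univ_sum (fun _ => Finset.univ)
    (fun i a => ∑ b, star (pauli (P i) a b) * pauli (Q i) a b)]
  simp only [sum_star_pauli_mul_pauli]
  rw [Finset.prod_ite_zero]
  simp [funext_iff]

lemma sum_norm_apply_sq_eq {n : ℕ} (α : (Fin n → Fin 4) → ℝ) :
    ∑ x, ∑ y, ‖(∑ P, (α P : ℂ) • pauliString P) x y‖ ^ 2 = 2 ^ n * ∑ P, α P ^ 2 := by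
  rw [← Complex.ofReal_inj]
  push_cast
  simp only [← Complex.conj_mul', ← Complex.star_def, Matrix.sum_apply, Matrix.smul_apply,
    smul_eq_mul, star_sum, star_mul', Finset.sum_mul_sum]
  calc _ = ∑ P, ∑ Q, (α P : ℂ) * α Q *
        ∑ x, ∑ y, star (pauliString P x y) * pauliString Q x y := by
        simp only [Finset.mul_sum]
        rw [Finset.sum_congr rfl fun x _ => Finset.sum_comm, Finset.sum_comm]
        refine Finset.sum_congr rfl fun P _ => ?_
        rw [Finset.sum_congr rfl fun x _ => Finset.sum_comm, Finset.sum_comm]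
        refine Finset.sum_congr rfl fun Q _ => Finset.sum_congr rfl fun x _ =>
          Finset.sum_congr rfl fun y _ => ?_
        simp only [Complex.star_def, Complex.conj_ofReal]
        ring
    _ = _ := by
        simp only [sum_star_pauliString_mul, mul_ite, mul_zero, Finset.sum_ite_eq,
          Finset.mem_univ, if_true, Finset.mul_sum]
        exact Finset.sum_congr rfl fun P _ => by ring

lemma sum_norm_apply_sq_le {ι : Type*} [Fintype ι] [DecidableEq ι] (A : Matrix ι ι ℂ) :
    ∑ x, ∑ y, ‖A x y‖ ^ 2 ≤
      Fintype.card ι * ‖Matrix.toEuclideanCLM (𝕜 := ℂ) A‖ ^ 2 := by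
  rw [Finset.sum_comm]
  calc _ ≤ ∑ _y : ι, ‖Matrix.toEuclideanCLM (𝕜 := ℂ) A‖ ^ 2 := by
        refine Finset.sum_le_sum fun y _ => ?_
        have h := (Matrix.toEuclideanCLM (𝕜 := ℂ) A).le_opNorm (EuclideanSpace.single y 1)
        rw [PiLp.norm_single, norm_one, mul_one] at h
        have h2 := pow_le_pow_left₀ (norm_nonneg _) h 2
        rw [EuclideanSpace.norm_sq_eq] at h2
        simpa [Matrix.ofLp_toEuclideanCLM] using h2
    _ = _ := by simp

lemma sum_sq_pauli_coeff_le {n : ℕ} (α : (Fin n → Fin 4) → ℝ) :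
    ∑ P, α P ^ 2 ≤
      ‖Matrix.toEuclideanCLM (𝕜 := ℂ) (∑ P, (α P : ℂ) • pauliString P)‖ ^ 2 := by
  have h := sum_norm_apply_sq_le (∑ P, (α P : ℂ) • pauliString P)
  rw [sum_norm_apply_sq_eq] at h
  simp only [Fintype.card_pi, Fintype.card_fin, Finset.prod_const, Finset.card_univ] at h
  push_cast at h
  exact le_of_mul_le_mul_left h (by positivity)

lemma measurable_matrix_apply {ι : Type*} (x y : ι) :
    Measurable fun ρ : Matrix ι ι ℂ => ρ x y :=
  (measurable_pi_apply y).comp (measurable_pi_apply x)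

lemma measurable_trace_mul {ι : Type*} [Fintype ι] (A : Matrix ι ι ℂ) :
    Measurable fun ρ : Matrix ι ι ℂ => (A * ρ).trace := by
  simp only [Matrix.trace, Matrix.diag_apply, Matrix.mul_apply]
  exact Finset.measurable_sum _ fun x _ => Finset.measurable_sum _ fun y _ =>
    (measurable_matrix_apply y x).const_mul _

lemma measurable_mul_mul {ι : Type*} [Fintype ι] (A B : Matrix ι ι ℂ) :
    Measurable fun ρ : Matrix ι ι ℂ => A * ρ * B := by
  refine measurable_pi_lambda _ fun x => measurable_pi_lambda _ fun y => ?_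
  simp only [Matrix.mul_apply]
  exact Finset.measurable_sum _ fun z _ => (Finset.measurable_sum _ fun w _ =>
    (measurable_matrix_apply w z).const_mul _).mul_const _

/-- The real part of the product of two Pauli coefficients of `ρ`. -/
noncomputable def pauliCorr {n : ℕ} (P Q : Fin n → Fin 4)
    (ρ : Matrix (Fin n → Fin 2) (Fin n → Fin 2) ℂ) : ℝ :=
  ((pauliString P * ρ).trace * star (pauliString Q * ρ).trace).re

lemma measurable_pauliCorr {n : ℕ} (P Q : Fin n → Fin 4) : Measurable (pauliCorr P Q) :=
  Complex.measurable_re.comp ((measurable_trace_mul _).mul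
    (continuous_star.measurable.comp (measurable_trace_mul _)))

lemma pauliCorr_self {n : ℕ} (P : Fin n → Fin 4)
    (ρ : Matrix (Fin n → Fin 2) (Fin n → Fin 2) ℂ) :
    pauliCorr P P ρ = ‖(pauliString P * ρ).trace‖ ^ 2 := by
  rw [pauliCorr, Complex.star_def, Complex.mul_conj', ← Complex.ofReal_pow, Complex.ofReal_re]

lemma norm_trace_pauliString_sq_le {n : ℕ} (P : Fin n → Fin 4)
    {ρ : Matrix (Fin n → Fin 2) (Fin n → Fin 2) ℂ} (hρ : ρ.PosSemidef) (htr : ρ.trace = 1) :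
    ‖(pauliString P * ρ).trace‖ ^ 2 ≤ 2 ^ n := by
  have h := sum_norm_trace_pauliString_sq_le Finset.univ hρ htr
  rw [Finset.card_univ, Fintype.card_fin] at h
  exact (Finset.single_le_sum (f := fun Q => ‖(pauliString Q * ρ).trace‖ ^ 2)
    (fun Q _ => sq_nonneg _) (by simp [pauliOn])).trans h

section LocallyFlat

variable {n : ℕ} {μ : Measure (Matrix (Fin n → Fin 2) (Fin n → Fin 2) ℂ)}

lemma integrable_pauliCorr [IsProbabilityMeasure μ]
    (hstate : ∀ᵐ ρ ∂μ, ρ.PosSemidef ∧ ρ.trace = 1) (P Q : Fin n → Fin 4) :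
    Integrable (pauliCorr P Q) μ := by
  refine Integrable.of_bound (measurable_pauliCorr P Q).aestronglyMeasurable (2 ^ n) ?_
  filter_upwards [hstate] with ρ ⟨hρ, htr⟩
  have h1 := norm_trace_pauliString_sq_le P hρ htr
  have h2 := norm_trace_pauliString_sq_le Q hρ htr
  refine (Complex.abs_re_le_norm _).trans ?_
  rw [norm_mul, norm_star]
  nlinarith [sq_nonneg (‖(pauliString P * ρ).trace‖ - ‖(pauliString Q * ρ).trace‖)]

lemma integral_pauliCorr_eq_mul
    (hinv : ∀ (i : Fin n) (U : Matrix (Fin 2) (Fin 2) ℂ), IsSingleQubitClifford U →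
      Measure.map (fun ρ => embedAt i U * ρ * (embedAt i U)ᴴ) μ = μ)
    {i : Fin n} {U : Matrix (Fin 2) (Fin 2) ℂ} (hU : IsSingleQubitClifford U)
    {P Q : Fin n → Fin 4} {p q : Fin 4} {c d : ℝ}
    (hP : Uᴴ * pauli (P i) * U = (c : ℂ) • pauli p)
    (hQ : Uᴴ * pauli (Q i) * U = (d : ℂ) • pauli q) :
    ∫ ρ, pauliCorr P Q ρ ∂μ =
      c * d * ∫ ρ, pauliCorr (Function.update P i p) (Function.update Q i q) ρ ∂μ := by
  conv_lhs => rw [← hinv i U hU]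
  rw [integral_map (measurable_mul_mul _ _).aemeasurable
    (measurable_pauliCorr P Q).aestronglyMeasurable, ← integral_const_mul]
  congr 1
  funext ρ
  simp only [pauliCorr]
  rw [trace_pauliString_embedAt_conj P i U c p hP, trace_pauliString_embedAt_conj Q i U d q hQ,
    star_mul', Complex.star_def, Complex.conj_ofReal, ← Complex.re_ofReal_mul]
  congr 1
  push_cast
  ring

lemma integral_pauliCorr_of_ne
    (hinv : ∀ (i : Fin n) (U : Matrix (Fin 2) (Fin 2) ℂ), IsSingleQubitClifford U →
      Measure.map (fun ρ => embedAt i U * ρ * (embedAt i U)ᴴ) μ = μ)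
    {P Q : Fin n → Fin 4} (h : P ≠ Q) : ∫ ρ, pauliCorr P Q ρ ∂μ = 0 := by
  obtain ⟨i, hi⟩ := Function.ne_iff.1 h
  obtain ⟨w, hw⟩ := exists_pauliSign_mul_eq_neg_one hi
  have hc : ∀ p, (pauli w)ᴴ * pauli p * pauli w = (pauliSign w p : ℂ) • pauli p := fun p => by
    rw [pauli_conjTranspose, pauli_conj_pauli]
  have := integral_pauliCorr_eq_mul hinv (isSingleQubitClifford_pauli w) (hc (P i)) (hc (Q i))
  rw [hw, Function.update_eq_self, Function.update_eq_self] at this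
  linarith

lemma integral_pauliCorr_update
    (hinv : ∀ (i : Fin n) (U : Matrix (Fin 2) (Fin 2) ℂ), IsSingleQubitClifford U →
      Measure.map (fun ρ => embedAt i U * ρ * (embedAt i U)ᴴ) μ = μ)
    {P : Fin n → Fin 4} {i : Fin n} {q : Fin 4} (h : P i = 0 ↔ q = 0) :
    ∫ ρ, pauliCorr (Function.update P i q) (Function.update P i q) ρ ∂μ =
      ∫ ρ, pauliCorr P P ρ ∂μ := by
  by_cases hpq : P i = q
  · rw [← hpq, Function.update_eq_self]
  · have hq : q ≠ 0 := fun hq => hpq ((h.2 hq).trans hq.symm)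
    have hp : P i ≠ 0 := mt h.1 hq
    have hc : (pauliSwap (P i) q)ᴴ * pauli (P i) * pauliSwap (P i) q =
        ((1 : ℝ) : ℂ) • pauli q := by
      rw [pauliSwap_conjTranspose, pauliSwap_conj_left hp hq hpq]; simp
    have := integral_pauliCorr_eq_mul hinv (isSingleQubitClifford_pauliSwap hp hq hpq) hc hc
    rw [this, one_mul, one_mul]

lemma integral_pauliCorr_eq_of_support_eq
    (hinv : ∀ (i : Fin n) (U : Matrix (Fin 2) (Fin 2) ℂ), IsSingleQubitClifford U →
      Measure.map (fun ρ => embedAt i U * ρ * (embedAt i U)ᴴ) μ = μ)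
    {P Q : Fin n → Fin 4} (h : ∀ i, P i = 0 ↔ Q i = 0) :
    ∫ ρ, pauliCorr Q Q ρ ∂μ = ∫ ρ, pauliCorr P P ρ ∂μ := by
  have key : ∀ T : Finset (Fin n),
      ∫ ρ, pauliCorr (T.piecewise Q P) (T.piecewise Q P) ρ ∂μ = ∫ ρ, pauliCorr P P ρ ∂μ := by
    intro T
    induction T using Finset.induction_on with
    | empty => simp
    | insert i T hi ih =>
      rw [Finset.piecewise_insert, integral_pauliCorr_update hinv, ih]
      simpa [hi] using h i
  simpa using key Finset.univ

lemma integral_pauliCorr_self_le [IsProbabilityMeasure μ]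
    (hstate : ∀ᵐ ρ ∂μ, ρ.PosSemidef ∧ ρ.trace = 1)
    (hinv : ∀ (i : Fin n) (U : Matrix (Fin 2) (Fin 2) ℂ), IsSingleQubitClifford U →
      Measure.map (fun ρ => embedAt i U * ρ * (embedAt i U)ᴴ) μ = μ)
    (P : Fin n → Fin 4) :
    ∫ ρ, pauliCorr P P ρ ∂μ ≤ (2 / 3 : ℝ) ^ (psupp P).card := by
  set T : Finset (Fin n → Fin 4) :=
    Fintype.piFinset fun i => if i ∈ psupp P then {0}ᶜ else {0} with hT
  have hcard : T.card = 3 ^ (psupp P).card := by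
    rw [hT, Fintype.card_piFinset]
    have : ∀ i, (if i ∈ psupp P then ({0}ᶜ : Finset (Fin 4)) else {0}).card =
        if i ∈ psupp P then 3 else 1 := by
      intro i; split_ifs <;> rfl
    simp [this]
  have hsub : T ⊆ pauliOn (psupp P) :=
    Fintype.piFinset_subset _ _ fun i => by split_ifs <;> simp
  have hmem : ∀ Q ∈ T, ∀ i, P i = 0 ↔ Q i = 0 := by
    intro Q hQ i
    have := Fintype.mem_piFinset.1 hQ i
    by_cases hi : P i = 0 <;> simp_all [psupp]
  have hsum : ∑ Q ∈ T, ∫ ρ, pauliCorr Q Q ρ ∂μ ≤ 2 ^ (psupp P).card := by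
    rw [← integral_finsetSum _ fun Q _ => integrable_pauliCorr hstate Q Q]
    have hle : ∀ᵐ ρ ∂μ, ∑ Q ∈ T, pauliCorr Q Q ρ ≤ 2 ^ (psupp P).card := by
      filter_upwards [hstate] with ρ ⟨hρ, htr⟩
      simp only [pauliCorr_self]
      exact (Finset.sum_le_sum_of_subset_of_nonneg hsub fun _ _ _ => sq_nonneg _).trans
        (sum_norm_trace_pauliString_sq_le _ hρ htr)
    refine (integral_mono_ae (integrable_finsetSum _ fun Q _ => integrable_pauliCorr hstate Q Q)
      (integrable_const _) hle).trans ?_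
    simp
  rw [Finset.sum_congr rfl fun Q hQ => integral_pauliCorr_eq_of_support_eq hinv (hmem Q hQ),
    Finset.sum_const, hcard, nsmul_eq_mul] at hsum
  push_cast at hsum
  rw [div_pow, le_div_iff₀ (by positivity), mul_comm]
  exact hsum

lemma integral_norm_trace_sq_eq [IsProbabilityMeasure μ]
    (hstate : ∀ᵐ ρ ∂μ, ρ.PosSemidef ∧ ρ.trace = 1)
    (hinv : ∀ (i : Fin n) (U : Matrix (Fin 2) (Fin 2) ℂ), IsSingleQubitClifford U →
      Measure.map (fun ρ => embedAt i U * ρ * (embedAt i U)ᴴ) μ = μ)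
    (β : (Fin n → Fin 4) → ℝ) :
    ∫ ρ, ‖((∑ P, (β P : ℂ) • pauliString P) * ρ).trace‖ ^ 2 ∂μ =
      ∑ P, β P ^ 2 * ∫ ρ, pauliCorr P P ρ ∂μ := by
  have hexp : ∀ ρ : Matrix (Fin n → Fin 2) (Fin n → Fin 2) ℂ,
      ‖((∑ P, (β P : ℂ) • pauliString P) * ρ).trace‖ ^ 2 =
        ∑ P, ∑ Q, β P * β Q * pauliCorr P Q ρ := by
    intro ρ
    rw [← Complex.ofReal_re (‖_‖ ^ 2), Complex.ofReal_pow, ← Complex.mul_conj',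
      ← Complex.star_def]
    simp only [Finset.sum_mul, Matrix.trace_sum, Matrix.smul_mul, Matrix.trace_smul, smul_eq_mul,
      star_sum, Finset.mul_sum, Complex.re_sum, star_mul', pauliCorr]
    rw [Finset.sum_comm]
    refine Finset.sum_congr rfl fun P _ => Finset.sum_congr rfl fun Q _ => ?_
    rw [Complex.star_def, Complex.conj_ofReal, ← Complex.re_ofReal_mul]
    congr 1
    push_cast
    ring
  have hint : ∀ P Q, Integrable (fun ρ => β P * β Q * pauliCorr P Q ρ) μ := fun P Q =>
    (integrable_pauliCorr hstate P Q).const_mul _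
  simp only [hexp]
  rw [integral_finsetSum _ fun P _ => integrable_finsetSum _ fun Q _ => hint P Q]
  refine Finset.sum_congr rfl fun P _ => ?_
  rw [integral_finsetSum _ fun Q _ => hint P Q, Finset.sum_eq_single P _ (by simp)]
  · rw [integral_const_mul, sq]
  · intro Q _ hQ
    rw [integral_const_mul, integral_pauliCorr_of_ne hinv hQ.symm, mul_zero]

end LocallyFlat

/-- Low-degree approximation under mean squared error: for an observable
`O = ∑_P α_P P` with weight-`< k` truncation `O^{(k)}`, and any distribution `𝒟`
over `n`-qubit states invariant under single-qubit Clifford gates on any qubit,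
`E_{ρ∼𝒟} |Tr(Oρ) - Tr(O^{(k)}ρ)|² ≤ (2/3)^k ‖O‖²` (spectral norm). -/
theorem low_degree_approximation (n k : ℕ) (α : (Fin n → Fin 4) → ℝ)
    (O Ok : Matrix (Fin n → Fin 2) (Fin n → Fin 2) ℂ)
    (hO : O = ∑ P : Fin n → Fin 4, (α P : ℂ) • pauliString P)
    (hOk : Ok = ∑ P : Fin n → Fin 4,
      if (psupp P).card < k then (α P : ℂ) • pauliString P else 0)
    (μ : Measure (Matrix (Fin n → Fin 2) (Fin n → Fin 2) ℂ)) [IsProbabilityMeasure μ]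
    (hstate : ∀ᵐ ρ ∂μ, ρ.PosSemidef ∧ ρ.trace = 1)
    (hinv : ∀ (i : Fin n) (U : Matrix (Fin 2) (Fin 2) ℂ), IsSingleQubitClifford U →
      Measure.map (fun ρ => embedAt i U * ρ * (embedAt i U)ᴴ) μ = μ) :
    ∫ ρ, ‖(O * ρ).trace - (Ok * ρ).trace‖ ^ 2 ∂μ ≤
      (2 / 3 : ℝ) ^ k * ‖Matrix.toEuclideanCLM (𝕜 := ℂ) O‖ ^ 2 := by
  set β : (Fin n → Fin 4) → ℝ := fun P => if (psupp P).card < k then 0 else α P with hβ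
  have hdiff : O - Ok = ∑ P, (β P : ℂ) • pauliString P := by
    rw [hO, hOk, ← Finset.sum_sub_distrib]
    refine Finset.sum_congr rfl fun P _ => ?_
    by_cases h : (psupp P).card < k <;> simp [hβ, h]
  simp only [← Matrix.trace_sub, ← Matrix.sub_mul, hdiff]
  rw [integral_norm_trace_sq_eq hstate hinv]
  calc _ ≤ ∑ P, (2 / 3 : ℝ) ^ k * α P ^ 2 := by
        refine Finset.sum_le_sum fun P _ => ?_
        by_cases h : (psupp P).card < k
        · simp only [hβ, h, if_true]
          rw [zero_pow two_ne_zero, zero_mul]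
          positivity
        · simp only [hβ, h, if_false]
          rw [mul_comm]
          refine mul_le_mul_of_nonneg_right ?_ (sq_nonneg _)
          exact (integral_pauliCorr_self_le hstate hinv P).trans
            (pow_le_pow_of_le_one (by norm_num) (by norm_num) (not_lt.1 h))
    _ ≤ _ := by
        rw [← Finset.mul_sum, hO]
        exact mul_le_mul_of_nonneg_left (sum_sq_pauli_coeff_le α) (by positivity)
end

section
/- Let O be a homogeneous 1-local n-qubit observable, i.e., O = ∑_{i=1}^n ∑_{j=1}^3 α_{ij} σ_j^{(i)} where σ_j^{(i)} is the Pauli matrix X, Y, or Z acting on qubit i. Let |ψ⟩ = ⊗_i |ψᵢ⟩ with each |ψᵢ⟩ an independent Haar-random single-qubit pure state. Then (1/√6)·√(Tr(O²)/2ⁿ) ≤ E_{|ψ⟩}|⟨ψ|O|ψ⟩| ≤ (1/√3)·√(Tr(O²)/2ⁿ). -/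
open scoped BigOperators
open Matrix MeasureTheory

/-- The single-qubit pure state `U|0⟩` as a vector in `ℂ²`. -/
noncomputable def haarVec (U : Matrix (Fin 2) (Fin 2) ℂ) : Fin 2 → ℂ :=
  U.mulVec (fun j => if j = 0 then 1 else 0)

/-- The product state `⊗ᵢ |ψᵢ⟩⟨ψᵢ|` with `|ψᵢ⟩ = Uᵢ|0⟩`. -/
noncomputable def productState {n : ℕ} (U : Fin n → Matrix (Fin 2) (Fin 2) ℂ) :
    Matrix (Fin n → Fin 2) (Fin n → Fin 2) ℂ :=
  fun x y => ∏ i, haarVec (U i) (x i) * (starRingEnd ℂ) (haarVec (U i) (y i))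

/-- The Walsh character `ε ↦ ∏_{i ∈ S} εᵢ` on the sign cube. -/
def walsh {ι : Type*} (S : Finset ι) (ε : ι → ℤˣ) : ℝ :=
  ∏ i ∈ S, ((ε i : ℤ) : ℝ)

/-- The unnormalised Walsh coefficient of a function on the sign cube. -/
def walshCoeff {ι : Type*} [Fintype ι] [DecidableEq ι] (f : (ι → ℤˣ) → ℝ) (S : Finset ι) : ℝ :=
  ∑ ε, f ε * walsh S ε

section Walsh

variable {ι : Type*}

lemma intSign_mul_self (u : ℤˣ) : ((u : ℤ) : ℝ) * ((u : ℤ) : ℝ) = 1 := by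
  rcases Int.units_eq_one_or u with rfl | rfl <;> norm_num

lemma walsh_mul (S : Finset ι) (ε δ : ι → ℤˣ) : walsh S (ε * δ) = walsh S ε * walsh S δ := by
  simp [walsh, Finset.prod_mul_distrib]

lemma walsh_neg_one (S : Finset ι) : walsh S (-1) = (-1) ^ S.card := by
  simp [walsh]

lemma sum_walsh_mul_walsh [Fintype ι] (x y : ι → ℤˣ) :
    ∑ S : Finset ι, walsh S x * walsh S y = if x = y then 2 ^ Fintype.card ι else 0 := by
  have h : ∑ S : Finset ι, walsh S x * walsh S y
      = ∏ i, (1 + ((x i : ℤ) : ℝ) * ((y i : ℤ) : ℝ)) := by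
    simp only [Finset.prod_one_add, Finset.powerset_univ, walsh, Finset.prod_mul_distrib]
  rw [h]
  split_ifs with hxy
  · subst hxy
    simp only [intSign_mul_self, Finset.prod_const, Finset.card_univ]
    norm_num
  · obtain ⟨i, hi⟩ := Function.ne_iff.mp hxy
    refine Finset.prod_eq_zero (Finset.mem_univ i) ?_
    rcases Int.units_eq_one_or (x i) with h1 | h1 <;>
    rcases Int.units_eq_one_or (y i) with h2 | h2 <;> simp_all

variable [DecidableEq ι]

lemma walsh_mulSingle (S : Finset ι) (i : ι) :
    walsh S (Pi.mulSingle i (-1)) = if i ∈ S then -1 else 1 := by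
  unfold walsh
  have h : ∀ j, (((Pi.mulSingle i (-1) : ι → ℤˣ) j : ℤ) : ℝ) = if j = i then -1 else 1 := by
    intro j
    by_cases hj : j = i
    · subst hj; simp
    · simp [hj]
  simp only [h, Finset.prod_ite_eq']

variable [Fintype ι]

lemma sum_walshCoeff_mul_walshCoeff (f g : (ι → ℤˣ) → ℝ) :
    ∑ S, walshCoeff f S * walshCoeff g S = 2 ^ Fintype.card ι * ∑ ε, f ε * g ε := by
  calc ∑ S, walshCoeff f S * walshCoeff g S
      = ∑ S, ∑ x, ∑ y, f x * g y * (walsh S x * walsh S y) := by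
        refine Finset.sum_congr rfl fun S _ => ?_
        rw [walshCoeff, walshCoeff, Finset.sum_mul_sum]
        refine Finset.sum_congr rfl fun x _ => Finset.sum_congr rfl fun y _ => by ring
    _ = ∑ x, ∑ y, f x * g y * ∑ S, walsh S x * walsh S y := by
        rw [Finset.sum_comm]
        refine Finset.sum_congr rfl fun x _ => ?_
        rw [Finset.sum_comm]
        simp only [Finset.mul_sum]
    _ = _ := by
        simp only [sum_walsh_mul_walsh, mul_ite, mul_zero, Finset.sum_ite_eq, Finset.mem_univ,
          if_true, Finset.mul_sum]
        refine Finset.sum_congr rfl fun x _ => by ring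

lemma walshCoeff_comp_mul (f : (ι → ℤˣ) → ℝ) (δ : ι → ℤˣ) (S : Finset ι) :
    walshCoeff (fun ε => f (ε * δ)) S = walsh S δ * walshCoeff f S := by
  have hδ : walsh S δ * walsh S δ = 1 := by
    simp only [walsh, ← Finset.prod_mul_distrib, intSign_mul_self, Finset.prod_const_one]
  rw [walshCoeff, walshCoeff, Finset.mul_sum, ← Equiv.sum_comp (Equiv.mulRight δ)
    (fun ε => walsh S δ * (f ε * walsh S ε))]
  refine Finset.sum_congr rfl fun ε _ => ?_
  simp only [Equiv.coe_mulRight, walsh_mul]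
  linear_combination -(f (ε * δ) * walsh S ε) * hδ

/-- The spectral gap inequality of the cube for even functions. -/
lemma even_poincare (f : (ι → ℤˣ) → ℝ) (hf : ∀ ε, f (ε * (-1)) = f ε) :
    4 * (2 ^ Fintype.card ι * ∑ ε, f ε ^ 2 - (∑ ε, f ε) ^ 2) ≤
      2 ^ Fintype.card ι * ∑ ε, f ε * ∑ i, (f ε - f (ε * Pi.mulSingle i (-1))) := by
  have hR : 2 ^ Fintype.card ι * ∑ ε, f ε * ∑ i, (f ε - f (ε * Pi.mulSingle i (-1)))
      = ∑ S, 2 * (S.card : ℝ) * walshCoeff f S ^ 2 := by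
    calc _ = ∑ i, (2 ^ Fintype.card ι * ∑ ε, f ε * f ε
            - 2 ^ Fintype.card ι * ∑ ε, f ε * f (ε * Pi.mulSingle i (-1))) := by
          simp only [← mul_sub, ← Finset.sum_sub_distrib, ← Finset.mul_sum]
          rw [Finset.sum_comm]
          simp only [← Finset.mul_sum]
      _ = ∑ i, ∑ S, (1 - walsh S (Pi.mulSingle i (-1))) * walshCoeff f S ^ 2 := by
          refine Finset.sum_congr rfl fun i _ => ?_
          have hflip := sum_walshCoeff_mul_walshCoeff f fun ε => f (ε * Pi.mulSingle i (-1))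
          beta_reduce at hflip
          rw [← sum_walshCoeff_mul_walshCoeff f f, ← hflip, ← Finset.sum_sub_distrib]
          refine Finset.sum_congr rfl fun S _ => ?_
          rw [walshCoeff_comp_mul]
          ring
      _ = _ := by
          rw [Finset.sum_comm]
          refine Finset.sum_congr rfl fun S _ => ?_
          rw [← Finset.sum_mul]
          congr 1
          have : ∀ i, (1 : ℝ) - walsh S (Pi.mulSingle i (-1)) = if i ∈ S then 2 else 0 := by
            intro i
            rw [walsh_mulSingle]
            split_ifs <;> norm_num
          simp only [this, Finset.sum_ite_mem, Finset.univ_inter, Finset.sum_const, nsmul_eq_mul]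
          ring
  have hL : 2 ^ Fintype.card ι * ∑ ε, f ε ^ 2 - (∑ ε, f ε) ^ 2
      = ∑ S, if S = ∅ then 0 else walshCoeff f S ^ 2 := by
    have h0 : ∑ ε, f ε = walshCoeff f ∅ := by simp [walshCoeff, walsh]
    have h1 : ∑ S, (if S = ∅ then 0 else walshCoeff f S ^ 2)
        = ∑ S, (walshCoeff f S * walshCoeff f S - if S = ∅ then walshCoeff f S ^ 2 else 0) := by
      refine Finset.sum_congr rfl fun S _ => ?_
      split_ifs <;> ring
    rw [h1, Finset.sum_sub_distrib, sum_walshCoeff_mul_walshCoeff, h0]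
    simp [sq]
  rw [hR, hL, Finset.mul_sum]
  refine Finset.sum_le_sum fun S _ => ?_
  split_ifs with hS
  · subst hS; simp
  · rcases Nat.even_or_odd S.card with he | ho
    · have h2 : 2 ≤ S.card := by
        have := Finset.card_pos.mpr (Finset.nonempty_iff_ne_empty.mpr hS)
        obtain ⟨k, hk⟩ := he
        omega
      have h2' : (2 : ℝ) ≤ S.card := by exact_mod_cast h2
      nlinarith [sq_nonneg (walshCoeff f S)]
    · have h := walshCoeff_comp_mul f (-1) S
      rw [walsh_neg_one, ho.neg_one_pow] at h
      simp only [hf] at h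
      have h0 : walshCoeff f S = 0 := by
        change walshCoeff f S = _ at h
        linarith
      simp [h0]

lemma sum_signs_sq (a : ι → ℝ) :
    ∑ ε : ι → ℤˣ, (∑ i, ((ε i : ℤ) : ℝ) * a i) ^ 2 = 2 ^ Fintype.card ι * ∑ i, a i ^ 2 := by
  have key : ∀ i j, ∑ ε : ι → ℤˣ, ((ε i : ℤ) : ℝ) * ((ε j : ℤ) : ℝ)
      = if i = j then 2 ^ Fintype.card ι else 0 := by
    intro i j
    split_ifs with hij
    · subst hij
      simp [intSign_mul_self]
    · have h := Equiv.sum_comp (Equiv.mulRight (Pi.mulSingle i (-1) : ι → ℤˣ))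
        (fun ε => ((ε i : ℤ) : ℝ) * ((ε j : ℤ) : ℝ))
      simp only [Equiv.coe_mulRight, Pi.mul_apply, Pi.mulSingle_eq_same,
        Pi.mulSingle_eq_of_ne (Ne.symm hij)] at h
      simp only [mul_neg, mul_one, Units.val_neg, Int.cast_neg, neg_mul,
        Finset.sum_neg_distrib] at h
      linarith
  calc _ = ∑ ε : ι → ℤˣ, ∑ i, ∑ j, a i * a j * (((ε i : ℤ) : ℝ) * ((ε j : ℤ) : ℝ)) := by
        refine Finset.sum_congr rfl fun ε _ => ?_
        rw [sq, Finset.sum_mul_sum]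
        refine Finset.sum_congr rfl fun x _ => Finset.sum_congr rfl fun y _ => by ring
    _ = ∑ i, ∑ j, a i * a j * ∑ ε : ι → ℤˣ, (((ε i : ℤ) : ℝ) * ((ε j : ℤ) : ℝ)) := by
        rw [Finset.sum_comm]
        refine Finset.sum_congr rfl fun x _ => ?_
        rw [Finset.sum_comm]
        simp only [Finset.mul_sum]
    _ = _ := by
        simp only [key, mul_ite, mul_zero, Finset.sum_ite_eq, Finset.mem_univ,
          if_true, Finset.mul_sum]
        refine Finset.sum_congr rfl fun x _ => by ring

/-- Khintchine's inequality with the sharp constant `1/√2`, by the argument of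
Latała and Oleszkiewicz. -/
lemma khintchine_signs_lower (a : ι → ℝ) :
    2 ^ Fintype.card ι * ((Real.sqrt 2)⁻¹ * Real.sqrt (∑ i, a i ^ 2)) ≤
      ∑ ε : ι → ℤˣ, |∑ i, ((ε i : ℤ) : ℝ) * a i| := by
  set f : (ι → ℤˣ) → ℝ := fun ε => |∑ i, ((ε i : ℤ) : ℝ) * a i| with hf
  have heven : ∀ ε, f (ε * (-1)) = f ε := by
    intro ε
    simp [hf, Finset.sum_neg_distrib]
  have hlap : ∀ ε, ∑ i, (f ε - f (ε * Pi.mulSingle i (-1))) ≤ 2 * f ε := by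
    intro ε
    set s := ∑ i, ((ε i : ℤ) : ℝ) * a i with hs
    have hflip : ∀ i, f (ε * Pi.mulSingle i (-1)) = |s - 2 * (((ε i : ℤ) : ℝ) * a i)| := by
      intro i
      simp only [hf]
      congr 1
      have h1 : ∀ j, (((ε * Pi.mulSingle i (-1) : ι → ℤˣ) j : ℤ) : ℝ) * a j
          = ((ε j : ℤ) : ℝ) * a j - if j = i then 2 * (((ε j : ℤ) : ℝ) * a j) else 0 := by
        intro j
        by_cases hj : j = i
        · subst hj; simp; ring
        · simp [hj]
      simp only [h1, Finset.sum_sub_distrib, Finset.sum_ite_eq', Finset.mem_univ, if_true, hs]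
    have hsum : ∑ i, (s - 2 * (((ε i : ℤ) : ℝ) * a i)) = ((Fintype.card ι : ℝ) - 2) * s := by
      rw [Finset.sum_sub_distrib, ← Finset.mul_sum, ← hs]
      simp
      ring
    have habs : ((Fintype.card ι : ℝ) - 2) * |s| ≤
        ∑ i, |s - 2 * (((ε i : ℤ) : ℝ) * a i)| := by
      refine le_trans ?_ (Finset.abs_sum_le_sum_abs _ _)
      rw [hsum, abs_mul]
      exact mul_le_mul_of_nonneg_right (le_abs_self _) (abs_nonneg _)
    have hfs : f ε = |s| := rfl
    simp only [Finset.sum_sub_distrib, hflip, hfs]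
    simp
    linarith
  have hpos : (0 : ℝ) < 2 ^ Fintype.card ι := by positivity
  have hbound : ∑ ε, f ε * ∑ i, (f ε - f (ε * Pi.mulSingle i (-1))) ≤ 2 * ∑ ε, f ε ^ 2 := by
    rw [Finset.mul_sum]
    refine Finset.sum_le_sum fun ε _ => ?_
    have := mul_le_mul_of_nonneg_left (hlap ε) (abs_nonneg _ : 0 ≤ f ε)
    linarith
  have hp := even_poincare f heven
  have hsq : ∑ ε, f ε ^ 2 = 2 ^ Fintype.card ι * ∑ i, a i ^ 2 := by
    simp only [hf, sq_abs, sum_signs_sq]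
  have hmain := hp.trans (mul_le_mul_of_nonneg_left hbound hpos.le)
  rw [hsq] at hmain
  have hnn : 0 ≤ ∑ i, a i ^ 2 := Finset.sum_nonneg fun i _ => sq_nonneg _
  refine abs_le_of_sq_le_sq' ?_ (Finset.sum_nonneg fun ε _ => abs_nonneg _) |>.2
  rw [mul_pow, mul_pow, inv_pow, Real.sq_sqrt hnn, Real.sq_sqrt (by norm_num)]
  change _ ≤ (∑ ε, f ε) ^ 2
  linarith

lemma khintchine_signs_upper (a : ι → ℝ) :
    ∑ ε : ι → ℤˣ, |∑ i, ((ε i : ℤ) : ℝ) * a i| ≤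
      2 ^ Fintype.card ι * Real.sqrt (∑ i, a i ^ 2) := by
  have hnn : 0 ≤ ∑ i, a i ^ 2 := Finset.sum_nonneg fun i _ => sq_nonneg _
  refine abs_le_of_sq_le_sq' ?_ (by positivity) |>.2
  have h := sq_sum_le_card_mul_sum_sq (s := (Finset.univ : Finset (ι → ℤˣ)))
    (f := fun ε => |∑ i, ((ε i : ℤ) : ℝ) * a i|)
  simp only [sq_abs, sum_signs_sq] at h
  refine h.trans (le_of_eq ?_)
  rw [mul_pow, Real.sq_sqrt hnn]
  simp
  ring

end Walsh

/-- The Bloch vector of a (not necessarily normalised) vector of `ℂ²`. -/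
noncomputable def blochVec (v : Fin 2 → ℂ) : Fin 3 → ℝ :=
  ![2 * ((v 0).re * (v 1).re + (v 0).im * (v 1).im),
    2 * ((v 0).re * (v 1).im - (v 0).im * (v 1).re),
    (v 0).re ^ 2 + (v 0).im ^ 2 - (v 1).re ^ 2 - (v 1).im ^ 2]

/-- The observable `n · σ`. -/
noncomputable def pauliDot (n : Fin 3 → ℝ) : Matrix (Fin 2) (Fin 2) ℂ :=
  !![(n 2 : ℂ), n 0 - n 1 * Complex.I; n 0 + n 1 * Complex.I, -n 2]

section Bloch

lemma haarVec_apply (U : Matrix (Fin 2) (Fin 2) ℂ) (i : Fin 2) : haarVec U i = U i 0 := by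
  simp [haarVec, Matrix.mulVec, dotProduct]

lemma haarVec_mul (V U : Matrix (Fin 2) (Fin 2) ℂ) : haarVec (V * U) = V.mulVec (haarVec U) := by
  simp only [haarVec, Matrix.mulVec_mulVec]

lemma pauliDot_mem_unitary {n : Fin 3 → ℝ} (hn : ∑ j, n j ^ 2 = 1) :
    pauliDot n ∈ unitary (Matrix (Fin 2) (Fin 2) ℂ) := by
  have hstar : star (pauliDot n) = pauliDot n := by
    ext i j
    fin_cases i <;> fin_cases j <;> simp [pauliDot, sub_eq_add_neg]
  have hsq : pauliDot n * pauliDot n = 1 := by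
    simp only [Fin.sum_univ_three] at hn
    ext i j
    fin_cases i <;> fin_cases j <;> apply Complex.ext <;>
      simp [pauliDot, Matrix.mul_apply, Fin.sum_univ_two] <;> nlinarith
  rw [Unitary.mem_iff, hstar]
  exact ⟨hsq, hsq⟩

lemma blochVec_pauliDot_mulVec {n : Fin 3 → ℝ} (hn : ∑ j, n j ^ 2 = 1) (v : Fin 2 → ℂ)
    (k : Fin 3) :
    blochVec ((pauliDot n).mulVec v) k = 2 * (∑ j, n j * blochVec v j) * n k - blochVec v k := by
  simp only [Fin.sum_univ_three] at hn ⊢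
  fin_cases k
  · simp [blochVec, pauliDot, Matrix.mulVec, dotProduct, Fin.sum_univ_two]
    linear_combination (-(2 * ((v 0).re * (v 1).re + (v 0).im * (v 1).im))) * hn
  · simp [blochVec, pauliDot, Matrix.mulVec, dotProduct, Fin.sum_univ_two]
    linear_combination (-(2 * ((v 0).re * (v 1).im - (v 0).im * (v 1).re))) * hn
  · simp [blochVec, pauliDot, Matrix.mulVec, dotProduct, Fin.sum_univ_two]
    linear_combination (-((v 0).re ^ 2 + (v 0).im ^ 2 - (v 1).re ^ 2 - (v 1).im ^ 2)) * hn

lemma exists_unit_half_turn (a b : Fin 3 → ℝ) (hab : ∑ j, a j ^ 2 = ∑ j, b j ^ 2) :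
    ∃ n : Fin 3 → ℝ, ∑ j, n j ^ 2 = 1 ∧ ∀ k, b k = 2 * (∑ j, a j * n j) * n k - a k := by
  by_cases h : ∃ c : Fin 3 → ℝ, ∑ j, c j ^ 2 ≠ 0 ∧
      ∀ k, (∑ j, c j ^ 2) * (a k + b k) = 2 * (∑ j, a j * c j) * c k
  · obtain ⟨c, hc, hk⟩ := h
    have hnn : 0 ≤ ∑ j, c j ^ 2 := Finset.sum_nonneg fun j _ => sq_nonneg _
    set s := Real.sqrt (∑ j, c j ^ 2) with hs
    have hss : s ^ 2 = ∑ j, c j ^ 2 := Real.sq_sqrt hnn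
    have hs0 : s ≠ 0 := fun h0 => hc (by rw [← hss, h0]; norm_num)
    refine ⟨fun j => c j / s, ?_, fun k => ?_⟩
    · simp only [div_pow]
      rw [← Finset.sum_div, ← hss, div_self (pow_ne_zero 2 hs0)]
    · have h1 := hk k
      rw [← hss] at h1
      simp only [← mul_div_assoc]
      rw [← Finset.sum_div]
      field_simp
      linarith
  · exfalso
    refine h ?_
    simp only [Fin.sum_univ_three] at hab ⊢
    by_cases h0 : (a 0 + b 0) ^ 2 + (a 1 + b 1) ^ 2 + (a 2 + b 2) ^ 2 = 0
    · have e0 : b 0 = -a 0 := by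
        nlinarith [sq_nonneg (a 0 + b 0), sq_nonneg (a 1 + b 1), sq_nonneg (a 2 + b 2)]
      have e1 : b 1 = -a 1 := by
        nlinarith [sq_nonneg (a 0 + b 0), sq_nonneg (a 1 + b 1), sq_nonneg (a 2 + b 2)]
      have e2 : b 2 = -a 2 := by
        nlinarith [sq_nonneg (a 0 + b 0), sq_nonneg (a 1 + b 1), sq_nonneg (a 2 + b 2)]
      by_cases h1 : a 1 ^ 2 + a 0 ^ 2 = 0
      · have z0 : a 0 = 0 := by nlinarith [sq_nonneg (a 0), sq_nonneg (a 1)]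
        refine ⟨![1, 0, 0], by simp, fun k => ?_⟩
        fin_cases k <;> simp [e0, e1, e2, z0]
      · refine ⟨![a 1, -a 0, 0], by simpa using h1, fun k => ?_⟩
        fin_cases k <;> simp [e0, e1, e2] <;> left <;> ring
    · refine ⟨fun j => a j + b j, h0, fun k => ?_⟩
      linear_combination (-(a k + b k)) * hab

lemma exists_unitary_rotation (a b : Fin 3 → ℝ) (hab : ∑ j, a j ^ 2 = ∑ j, b j ^ 2) :
    ∃ V ∈ unitary (Matrix (Fin 2) (Fin 2) ℂ), ∀ U : Matrix (Fin 2) (Fin 2) ℂ,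
      ∑ j, a j * blochVec (haarVec (V * U)) j = ∑ j, b j * blochVec (haarVec U) j := by
  obtain ⟨n, hn, hb⟩ := exists_unit_half_turn a b hab
  refine ⟨pauliDot n, pauliDot_mem_unitary hn, fun U => ?_⟩
  simp only [haarVec_mul, blochVec_pauliDot_mulVec hn, hb, Fin.sum_univ_three]
  ring

lemma normSq_haarVec {U : Matrix (Fin 2) (Fin 2) ℂ}
    (hU : U ∈ unitary (Matrix (Fin 2) (Fin 2) ℂ)) :
    (haarVec U 0).re ^ 2 + (haarVec U 0).im ^ 2 +
      ((haarVec U 1).re ^ 2 + (haarVec U 1).im ^ 2) = 1 := by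
  have h := congrArg Complex.re (congrFun (congrFun (Unitary.mem_iff.mp hU).1 0) 0)
  simp [Matrix.mul_apply, Fin.sum_univ_two, Matrix.star_apply] at h
  simp only [haarVec_apply]
  linarith

lemma sum_blochVec_sq {U : Matrix (Fin 2) (Fin 2) ℂ}
    (hU : U ∈ unitary (Matrix (Fin 2) (Fin 2) ℂ)) :
    ∑ j, blochVec (haarVec U) j ^ 2 = 1 := by
  have h := normSq_haarVec hU
  simp only [Fin.sum_univ_three, blochVec]
  simp
  set p := (haarVec U 0).re
  set q := (haarVec U 0).im
  set r := (haarVec U 1).re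
  set s := (haarVec U 1).im
  linear_combination (p ^ 2 + q ^ 2 + (r ^ 2 + s ^ 2) + 1) * h

lemma measurable_blochVec_haarVec (j : Fin 3) :
    Measurable fun U : Matrix (Fin 2) (Fin 2) ℂ => blochVec (haarVec U) j := by
  have hm : ∀ i k : Fin 2, Measurable fun U : Matrix (Fin 2) (Fin 2) ℂ => U i k := fun i k =>
    (measurable_pi_apply k).comp (measurable_pi_apply i)
  have h0 := hm 0 0
  have h1 := hm 1 0
  fin_cases j <;> simp only [blochVec, haarVec_apply] <;> simp <;> fun_prop

lemma measurable_const_mul_matrix (V : Matrix (Fin 2) (Fin 2) ℂ) :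
    Measurable fun U : Matrix (Fin 2) (Fin 2) ℂ => V * U := by
  have hm : ∀ i k : Fin 2, Measurable fun U : Matrix (Fin 2) (Fin 2) ℂ => U i k := fun i k =>
    (measurable_pi_apply k).comp (measurable_pi_apply i)
  refine measurable_pi_lambda _ fun i => measurable_pi_lambda _ fun k => ?_
  simp only [Matrix.mul_apply, Fin.sum_univ_two]
  exact ((hm 0 k).const_mul _).add ((hm 1 k).const_mul _)

end Bloch

section Trace

variable {n : ℕ}

lemma trace_mul_of_prod (A B : Fin n → Matrix (Fin 2) (Fin 2) ℂ) :
    ((Matrix.of fun x y : Fin n → Fin 2 => ∏ i, A i (x i) (y i)) *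
      Matrix.of fun x y : Fin n → Fin 2 => ∏ i, B i (x i) (y i)).trace
      = ∏ i, (A i * B i).trace := by
  simp only [Matrix.trace, Matrix.diag, Matrix.mul_apply, Matrix.of_apply, ← Finset.prod_mul_distrib]
  simp only [Finset.prod_univ_sum, Fintype.piFinset_univ]

lemma trace_pauli_mul_pauli (a b : Fin 4) :
    (pauli a * pauli b).trace = if a = b then 2 else 0 := by
  fin_cases a <;> fin_cases b <;>
    simp [pauli, Matrix.trace_fin_two] <;> norm_num

lemma trace_pauliString_mul_pauliString (P Q : Fin n → Fin 4) :
    (pauliString P * pauliString Q).trace = if P = Q then 2 ^ n else 0 := by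
  refine (trace_mul_of_prod (fun i => pauli (P i)) (fun i => pauli (Q i))).trans ?_
  simp only [trace_pauli_mul_pauli]
  split_ifs with h
  · subst h; simp
  · obtain ⟨i, hi⟩ := Function.ne_iff.mp h
    exact Finset.prod_eq_zero (Finset.mem_univ i) (by simp [hi])

lemma trace_one_local_sq (α : Fin n → Fin 3 → ℝ) :
    ((∑ i : Fin n, ∑ j : Fin 3,
        (α i j : ℂ) • pauliString (fun l : Fin n => if l = i then j.succ else 0)) *
      (∑ i : Fin n, ∑ j : Fin 3,
        (α i j : ℂ) • pauliString (fun l : Fin n => if l = i then j.succ else 0))).trace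
      = 2 ^ n * ∑ i, ∑ j, (α i j : ℂ) ^ 2 := by
  have hinj : ∀ p q : Fin n × Fin 3,
      ((fun l : Fin n => if l = p.1 then p.2.succ else 0) =
        fun l : Fin n => if l = q.1 then q.2.succ else 0) ↔ p = q := by
    intro p q
    refine ⟨fun h => ?_, fun h => by rw [h]⟩
    have h1 := congrFun h p.1
    simp only [if_true] at h1
    split_ifs at h1 with h2
    · exact Prod.ext h2 (Fin.succ_injective _ h1)
    · exact absurd h1 (Fin.succ_ne_zero _)
  simp only [← Fintype.sum_prod_type']
  rw [Finset.sum_mul_sum, Matrix.trace_sum, Finset.mul_sum]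
  refine Finset.sum_congr rfl fun p _ => ?_
  simp only [Matrix.trace_sum, smul_mul_smul_comm, Matrix.trace_smul,
    trace_pauliString_mul_pauliString, hinj, smul_eq_mul, mul_ite, mul_zero, Finset.sum_ite_eq,
    Finset.mem_univ, if_true]
  ring

lemma trace_pauli_succ_mul_pure (v : Fin 2 → ℂ) (j : Fin 3) :
    (pauli j.succ * Matrix.vecMulVec v (star v)).trace
      = (blochVec v j : ℂ) := by
  fin_cases j <;> apply Complex.ext <;>
    simp [pauli, blochVec, Matrix.trace_fin_two, Matrix.vecMulVec_apply,
      Matrix.vecMul, dotProduct, Fin.sum_univ_two, sq] <;> ring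

lemma trace_pauli_zero_mul_pure {U : Matrix (Fin 2) (Fin 2) ℂ}
    (hU : U ∈ unitary (Matrix (Fin 2) (Fin 2) ℂ)) :
    (pauli 0 * Matrix.vecMulVec (haarVec U) (star (haarVec U))).trace = 1 := by
  have h := normSq_haarVec hU
  apply Complex.ext
  · simp [pauli]
    linarith
  · simp [pauli]
    ring

lemma trace_one_local_mul_productState (α : Fin n → Fin 3 → ℝ)
    {U : Fin n → Matrix (Fin 2) (Fin 2) ℂ}
    (hU : ∀ i, U i ∈ unitary (Matrix (Fin 2) (Fin 2) ℂ)) :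
    ((∑ i : Fin n, ∑ j : Fin 3,
        (α i j : ℂ) • pauliString (fun l : Fin n => if l = i then j.succ else 0)) *
      productState U).trace = ((∑ i, ∑ j, α i j * blochVec (haarVec (U i)) j : ℝ) : ℂ) := by
  have key : ∀ i j, (pauliString (fun l : Fin n => if l = i then (j : Fin 3).succ else 0) *
      productState U).trace = (blochVec (haarVec (U i)) j : ℂ) := by
    intro i j
    refine (trace_mul_of_prod (fun l => pauli (if l = i then j.succ else 0))
      (fun l => Matrix.vecMulVec (haarVec (U l)) (star (haarVec (U l))))).trans ?_
    rw [Finset.prod_eq_single i]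
    · simp only [if_true]
      exact trace_pauli_succ_mul_pure _ _
    · intro l _ hl
      simp only [hl, if_false]
      exact trace_pauli_zero_mul_pure (hU l)
    · simp
  push_cast
  simp only [Finset.sum_mul, Matrix.trace_sum, smul_mul_assoc, Matrix.trace_smul, key, smul_eq_mul]

end Trace

section Haar

variable {n : ℕ} {μ : Measure (Matrix (Fin 2) (Fin 2) ℂ)} [IsProbabilityMeasure μ]

lemma ae_pi_unitary (hunit : ∀ᵐ U ∂μ, U ∈ unitary (Matrix (Fin 2) (Fin 2) ℂ)) :
    ∀ᵐ U ∂(Measure.pi fun _ : Fin n => μ),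
      ∀ i, U i ∈ unitary (Matrix (Fin 2) (Fin 2) ℂ) :=
  ae_all_iff.mpr fun i => (Measure.tendsto_eval_ae_ae (μ := fun _ : Fin n => μ) (i := i)) hunit

lemma measurable_sum_blochVec (β : Fin n → Fin 3 → ℝ) :
    Measurable fun U : Fin n → Matrix (Fin 2) (Fin 2) ℂ =>
      |∑ i, ∑ j, β i j * blochVec (haarVec (U i)) j| := by
  have h : ∀ i j, Measurable fun U : Fin n → Matrix (Fin 2) (Fin 2) ℂ =>
      blochVec (haarVec (U i)) j := fun i j =>
    (measurable_blochVec_haarVec j).comp (measurable_pi_apply i)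
  fun_prop

lemma integrable_abs_sum_blochVec
    (hunit : ∀ᵐ U ∂μ, U ∈ unitary (Matrix (Fin 2) (Fin 2) ℂ)) (β : Fin n → Fin 3 → ℝ) :
    Integrable (fun U => |∑ i, ∑ j, β i j * blochVec (haarVec (U i)) j|)
      (Measure.pi fun _ : Fin n => μ) := by
  refine Integrable.of_bound (measurable_sum_blochVec β).aestronglyMeasurable
    (∑ i, ∑ j, |β i j|) ?_
  filter_upwards [ae_pi_unitary hunit] with U hU
  rw [Real.norm_eq_abs, abs_abs]
  refine (Finset.abs_sum_le_sum_abs _ _).trans (Finset.sum_le_sum fun i _ => ?_)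
  refine (Finset.abs_sum_le_sum_abs _ _).trans (Finset.sum_le_sum fun j _ => ?_)
  rw [abs_mul]
  refine mul_le_of_le_one_right (abs_nonneg _) (abs_le_one_iff_mul_self_le_one.mpr ?_)
  rw [← sq, ← sum_blochVec_sq (hU i)]
  exact Finset.single_le_sum (f := fun j => blochVec (haarVec (U i)) j ^ 2)
    (fun j _ => sq_nonneg _) (Finset.mem_univ j)

/-- The mean only depends on the norms of the coefficient vectors. -/
lemma integral_abs_sum_blochVec_congr
    (hinv : ∀ V ∈ unitary (Matrix (Fin 2) (Fin 2) ℂ), Measure.map (fun U => V * U) μ = μ)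
    {α β : Fin n → Fin 3 → ℝ} (h : ∀ i, ∑ j, α i j ^ 2 = ∑ j, β i j ^ 2) :
    ∫ U, |∑ i, ∑ j, α i j * blochVec (haarVec (U i)) j| ∂(Measure.pi fun _ : Fin n => μ) =
      ∫ U, |∑ i, ∑ j, β i j * blochVec (haarVec (U i)) j| ∂(Measure.pi fun _ : Fin n => μ) := by
  choose V hV hrot using fun i => exists_unitary_rotation (α i) (β i) (h i)
  have hmp : MeasurePreserving
      (fun (U : Fin n → Matrix (Fin 2) (Fin 2) ℂ) i => V i * U i)
      (Measure.pi fun _ : Fin n => μ) (Measure.pi fun _ : Fin n => μ) :=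
    measurePreserving_pi _ _ fun i => ⟨measurable_const_mul_matrix (V i), hinv (V i) (hV i)⟩
  conv_lhs => rw [← hmp.map_eq]
  rw [integral_map hmp.measurable.aemeasurable (measurable_sum_blochVec α).aestronglyMeasurable]
  simp only [hrot]

/-- Averaging over the eight vertices of a cube inscribed in each Bloch sphere. -/
lemma card_mul_integral_abs_sum_blochVec
    (hunit : ∀ᵐ U ∂μ, U ∈ unitary (Matrix (Fin 2) (Fin 2) ℂ))
    (hinv : ∀ V ∈ unitary (Matrix (Fin 2) (Fin 2) ℂ), Measure.map (fun U => V * U) μ = μ)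
    {α : Fin n → Fin 3 → ℝ} {c : Fin n → ℝ} (h : ∀ i, ∑ j, α i j ^ 2 = 3 * c i ^ 2) :
    2 ^ Fintype.card (Fin n × Fin 3) *
        ∫ U, |∑ i, ∑ j, α i j * blochVec (haarVec (U i)) j| ∂(Measure.pi fun _ : Fin n => μ) =
      ∫ U, ∑ ε : Fin n × Fin 3 → ℤˣ,
        |∑ p, ((ε p : ℤ) : ℝ) * (c p.1 * blochVec (haarVec (U p.1)) p.2)|
        ∂(Measure.pi fun _ : Fin n => μ) := by
  have hsum : ∀ (ε : Fin n × Fin 3 → ℤˣ) (U : Fin n → Matrix (Fin 2) (Fin 2) ℂ),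
      ∑ p, ((ε p : ℤ) : ℝ) * (c p.1 * blochVec (haarVec (U p.1)) p.2) =
        ∑ i, ∑ j, (((ε (i, j) : ℤ) : ℝ) * c i) * blochVec (haarVec (U i)) j := by
    intro ε U
    simp only [Fintype.sum_prod_type, mul_assoc]
  simp only [hsum]
  rw [integral_finsetSum _ fun ε _ => integrable_abs_sum_blochVec hunit _]
  have hε : ∀ ε : Fin n × Fin 3 → ℤˣ,
      ∫ U, |∑ i, ∑ j, (((ε (i, j) : ℤ) : ℝ) * c i) * blochVec (haarVec (U i)) j|
        ∂(Measure.pi fun _ : Fin n => μ) =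
      ∫ U, |∑ i, ∑ j, α i j * blochVec (haarVec (U i)) j| ∂(Measure.pi fun _ : Fin n => μ) := by
    intro ε
    refine integral_abs_sum_blochVec_congr hinv fun i => ?_
    rw [h i]
    simp only [mul_pow, sq ((_ : ℤ) : ℝ), intSign_mul_self, one_mul]
    simp
  simp only [hε]
  simp

end Haar

/-- Khintchine inequality for homogeneous 1-local observables: for
`O = ∑_{i,j} α_{ij} σ_j^{(i)}` and `|ψ⟩ = ⊗ᵢ|ψᵢ⟩` a product of independent
Haar-random single-qubit pure states (`|ψᵢ⟩ = Uᵢ|0⟩` with `Uᵢ` Haar on the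
unitary group),
`(1/√6) √(Tr(O²)/2ⁿ) ≤ E|⟨ψ|O|ψ⟩| ≤ (1/√3) √(Tr(O²)/2ⁿ)`. -/
theorem khintchine_one_local (n : ℕ) (α : Fin n → Fin 3 → ℝ)
    (O : Matrix (Fin n → Fin 2) (Fin n → Fin 2) ℂ)
    (hO : O = ∑ i : Fin n, ∑ j : Fin 3,
      (α i j : ℂ) • pauliString (fun l => if l = i then j.succ else 0))
    (μ : Measure (Matrix (Fin 2) (Fin 2) ℂ)) [IsProbabilityMeasure μ]
    (hunit : ∀ᵐ U ∂μ, U ∈ unitary (Matrix (Fin 2) (Fin 2) ℂ))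
    (hinv : ∀ V ∈ unitary (Matrix (Fin 2) (Fin 2) ℂ),
      Measure.map (fun U => V * U) μ = μ) :
    (Real.sqrt 6)⁻¹ * Real.sqrt (((O * O).trace).re / 2 ^ n) ≤
        ∫ U, ‖(O * productState U).trace‖ ∂(Measure.pi fun _ : Fin n => μ) ∧
    ∫ U, ‖(O * productState U).trace‖ ∂(Measure.pi fun _ : Fin n => μ) ≤
        (Real.sqrt 3)⁻¹ * Real.sqrt (((O * O).trace).re / 2 ^ n) := by
  have htr : ((O * O).trace).re / 2 ^ n = ∑ i, ∑ j, α i j ^ 2 := by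
    have h : (O * O).trace = ((2 ^ n * ∑ i, ∑ j, α i j ^ 2 : ℝ) : ℂ) := by
      rw [hO, trace_one_local_sq]
      push_cast
      rfl
    rw [h, Complex.ofReal_re, mul_div_cancel_left₀ _ (by positivity)]
  have hint : ∫ U, ‖(O * productState U).trace‖ ∂(Measure.pi fun _ : Fin n => μ) =
      ∫ U, |∑ i, ∑ j, α i j * blochVec (haarVec (U i)) j| ∂(Measure.pi fun _ : Fin n => μ) := by
    refine integral_congr_ae ?_
    filter_upwards [ae_pi_unitary hunit] with U hU
    rw [hO, trace_one_local_mul_productState α hU, Complex.norm_real, Real.norm_eq_abs]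
  rw [htr, hint]
  set A := ∑ i, ∑ j, α i j ^ 2 with hA
  set E := ∫ U, |∑ i, ∑ j, α i j * blochVec (haarVec (U i)) j| ∂(Measure.pi fun _ : Fin n => μ)
  set c : Fin n → ℝ := fun i => Real.sqrt ((∑ j, α i j ^ 2) / 3) with hc
  have hc2 : ∀ i, ∑ j, α i j ^ 2 = 3 * c i ^ 2 := by
    intro i
    have h0 : 0 ≤ ∑ j, α i j ^ 2 := Finset.sum_nonneg fun j _ => sq_nonneg _
    rw [hc, Real.sq_sqrt (by positivity)]
    ring
  have havg := card_mul_integral_abs_sum_blochVec hunit hinv hc2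
  have hnorm : ∀ U : Fin n → Matrix (Fin 2) (Fin 2) ℂ,
      (∀ i, U i ∈ unitary (Matrix (Fin 2) (Fin 2) ℂ)) →
      ∑ p : Fin n × Fin 3, (c p.1 * blochVec (haarVec (U p.1)) p.2) ^ 2 = A / 3 := by
    intro U hU
    rw [Fintype.sum_prod_type, hA, Finset.sum_div]
    refine Finset.sum_congr rfl fun i _ => ?_
    simp only [mul_pow, ← Finset.mul_sum, sum_blochVec_sq (hU i), hc2 i]
    ring
  have hpos : (0 : ℝ) < 2 ^ Fintype.card (Fin n × Fin 3) := by positivity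
  have hI : Integrable (fun U => ∑ ε : Fin n × Fin 3 → ℤˣ,
        |∑ p, ((ε p : ℤ) : ℝ) * (c p.1 * blochVec (haarVec (U p.1)) p.2)|)
        (Measure.pi fun _ : Fin n => μ) := by
    refine integrable_finsetSum _ fun ε _ => ?_
    have := integrable_abs_sum_blochVec (n := n) hunit fun i j => ((ε (i, j) : ℤ) : ℝ) * c i
    simpa only [Fintype.sum_prod_type, mul_assoc] using this
  have hsqrt : Real.sqrt (A / 3) = (Real.sqrt 3)⁻¹ * Real.sqrt A := by
    rw [Real.sqrt_div' _ (by norm_num)]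
    ring
  constructor
  · refine le_of_mul_le_mul_left ?_ hpos
    rw [havg]
    have h6 : (Real.sqrt 6)⁻¹ * Real.sqrt A = (Real.sqrt 2)⁻¹ * Real.sqrt (A / 3) := by
      rw [hsqrt, show (6 : ℝ) = 2 * 3 by norm_num, Real.sqrt_mul (by norm_num)]
      ring
    rw [h6]
    calc
      _ = ∫ _U, 2 ^ Fintype.card (Fin n × Fin 3) * ((Real.sqrt 2)⁻¹ * Real.sqrt (A / 3))
          ∂(Measure.pi fun _ : Fin n => μ) := by simp
      _ ≤ _ := by
        refine integral_mono_ae (integrable_const _) hI ?_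
        filter_upwards [ae_pi_unitary hunit] with U hU
        rw [← hnorm U hU]
        exact khintchine_signs_lower _
  · refine le_of_mul_le_mul_left ?_ hpos
    rw [havg, ← hsqrt]
    calc
      _ ≤ ∫ _U, 2 ^ Fintype.card (Fin n × Fin 3) * Real.sqrt (A / 3)
          ∂(Measure.pi fun _ : Fin n => μ) := by
        refine integral_mono_ae hI (integrable_const _) ?_
        filter_upwards [ae_pi_unitary hunit] with U hU
        rw [← hnorm U hU]
        exact khintchine_signs_upper _
      _ = _ := by simp
end
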